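/- Let n ≥ 1, let f:ℝⁿ→ℝⁿ be a C² function with ‖d²f‖_∞ < +∞, let x₀ ∈ ℝⁿ, let x:ℝ→ℝⁿ be the solution of ẋ = f(x) with x(0)=x₀, and let μ:ℝ→ℝⁿ be a C¹ function with μ(0)=x₀. Set η(t) = μ(t) − x(t). Then η(0)=0 and for every t ∈ ℝ, ‖η̇(t) − [μ̇(t) − f(μ(t)) + df(μ(t)) η(t)]‖ ≤ ‖d²f‖_∞ · ‖η(t)‖²; i.e. η satisfies the linearized equation η̇ = μ̇(t) − f(μ(t)) + df(μ(t))η + r(t) with a remainder r bounded by ‖d²f‖_∞‖η(t)‖². -/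

import Mathlib

open scoped BigOperators
open MeasureTheory Filter Matrix

noncomputable section

/-- `σ(M)`: sum of all entries of a matrix. -/
def sigmaM {q p : ℕ} (M : Matrix (Fin q) (Fin p) ℝ) : ℝ := ∑ i, ∑ j, M i j

/-- `σ(v)`: sum of the coordinates of a vector. -/
def sigmaV {q : ℕ} (v : Fin q → ℝ) : ℝ := ∑ i, v i

/-- `IM q i` for `1 ≤ i ≤ q`: the diagonal matrix whose `i`-th (1-based) diagonal entry is `-1`
and all other diagonal entries are `1`.  `IM q 0` is the identity matrix. -/
def IM (q : ℕ) (i : ℕ) : Matrix (Fin q) (Fin q) ℝ :=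
  Matrix.diagonal fun j => if (j : ℕ) + 1 = i then (-1 : ℝ) else 1

/-- Operator norm of a matrix induced by the max-norm: the maximal absolute row sum. -/
def matNorm {q p : ℕ} (M : Matrix (Fin q) (Fin p) ℝ) : ℝ := ⨆ i, ∑ j, |M i j|

/-- Norm of a 3-tensor `H`, viewed as the family of quadratic-form slices, induced by the
max-norm. -/
def tensNorm {q : ℕ} (H : Fin q → Matrix (Fin q) (Fin q) ℝ) : ℝ := ⨆ i, ∑ j, ∑ k, |H i j k|

/-- `yᵀ H y`: the vector of quadratic forms determined by the slices of the 3-tensor `H`. -/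
def quadVec {q : ℕ} (H : Fin q → Matrix (Fin q) (Fin q) ℝ) (y : Fin q → ℝ) : Fin q → ℝ :=
  fun i => ∑ j, ∑ k, y j * H i j k * y k

/-- The Jacobian matrix of `h` at `x` (for the max-norm setting). -/
def jac {q p : ℕ} (h : (Fin q → ℝ) → Fin p → ℝ) (x : Fin q → ℝ) : Matrix (Fin p) (Fin q) ℝ :=
  Matrix.of fun i j => fderiv ℝ h x (Pi.single j 1) i

/-- `𝒦_q⁺ = {I_{i,q} : i = 0,…,q}`. -/
def KqPlus (q : ℕ) : Set (Matrix (Fin q) (Fin q) ℝ) := {M | ∃ i : Fin (q + 1), M = IM q i}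

/-- `𝒦_q = 𝒦_q⁺ ∪ {-I : I ∈ 𝒦_q⁺}`. -/
def Kq (q : ℕ) : Set (Matrix (Fin q) (Fin q) ℝ) := KqPlus q ∪ (fun M => -M) '' KqPlus q

/-- A function on `ℝ^q` is periodic if it is `1`-periodic in each of its variables. -/
def PeriodicFun {q : ℕ} {E : Type*} (g : (Fin q → ℝ) → E) : Prop :=
  ∀ (z : Fin q → ℝ) (j : Fin q), g (z + Pi.single j 1) = g z

/-- `μ` is a leader trajectory of `h`. -/
def IsLeaderTraj {q : ℕ} (h : (Fin q → ℝ) → Fin q → ℝ) (μ : ℝ → Fin q → ℝ) : Prop :=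
  (∃ C, ∀ t : ℝ, |∫ ν in (0:ℝ)..t, sigmaM (jac h (μ ν))| ≤ C) ∧
  ∃ τ : Fin q → ℝ,
    (∀ i, τ i = 1 ∨ τ i = -1) ∧
    (∀ i : Fin q, ∃ C, ∀ t : ℝ, 0 ≤ t →
      (∫ ν in (0:ℝ)..t,
        τ i * sigmaM (IM q ((i : ℕ) + 1) * jac h (μ (τ i * ν)) * IM q ((i : ℕ) + 1))) ≤ C) ∧
    ∃ ψ : Fin (q + 1) → ℝ → ℝ,
      (∀ i : Fin (q + 1), ψ i 0 = 0 ∧ ∀ t : ℝ, HasDerivAt (ψ i)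
        (sigmaV (IM q (i : ℕ) *ᵥ deriv μ t - IM q (i : ℕ) *ᵥ h (μ t)) +
          (1 / (q : ℝ)) * sigmaM (IM q (i : ℕ) * jac h (μ t) * IM q (i : ℕ)) * ψ i t) t) ∧
      ∀ i : Fin q, ∃ C, ∀ t : ℝ, |ψ 0 (τ i * t) - ψ i.succ (τ i * t)| ≤ C

/-- The functions `Ψ_i[g](z,t)` of the Proposition (with `I_z` the diagonal matrix of `z`). -/
def PsiG {q : ℕ} (g : (Fin q → ℝ) → Fin q → ℝ) (i : ℕ) (z : Fin q → ℝ) (t : ℝ) : ℝ :=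
  ∫ s in (0:ℝ)..t,
    sigmaV (IM q i *ᵥ ((1 : Fin q → ℝ) - (Matrix.diagonal z)⁻¹ *ᵥ g (s • z))) *
      Real.exp ((1 / (q : ℝ)) * ∫ ν in s..t,
        sigmaM (IM q i * (Matrix.diagonal z)⁻¹ * jac g (ν • z) * Matrix.diagonal z * IM q i))

/-- The functions `Ψ_i[f_{x₀}](ρ,t)` of the Main result. -/
def PsiF {n : ℕ} (f : (Fin n → ℝ) → Fin n → ℝ) (x₀ : Fin n → ℝ) (i : ℕ) (ρ : Fin n → ℝ)
    (t : ℝ) : ℝ :=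
  ∫ s in (0:ℝ)..t,
    sigmaV (IM n i *ᵥ (ρ - f (s • ρ + x₀))) *
      Real.exp ((1 / (n : ℝ)) * ∫ ν in s..t, sigmaM (IM n i * jac f (ν • ρ + x₀) * IM n i))

/-- The `q × q` matrix all of whose entries are `1`. -/
def onesM (q : ℕ) : Matrix (Fin q) (Fin q) ℝ := Matrix.of fun _ _ => 1


/-- First-order Taylor estimate: if the second derivative of `f` is bounded by `C`, then the
linearization of `f` at `a` has an error of at most `C * ‖b - a‖ ^ 2` at `b`. -/
theorem norm_sub_sub_fderiv_le_mul_sq {E F : Type*} [NormedAddCommGroup E] [NormedSpace ℝ E]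
    [NormedAddCommGroup F] [NormedSpace ℝ F] {f : E → F} (hf : ContDiff ℝ 2 f) {C : ℝ}
    (hC : ∀ z, ‖fderiv ℝ (fderiv ℝ f) z‖ ≤ C) (a b : E) :
    ‖f b - f a - fderiv ℝ f a (b - a)‖ ≤ C * ‖b - a‖ ^ 2 := by
  have hd : Differentiable ℝ f := hf.differentiable (by norm_num)
  have hd' : Differentiable ℝ (fderiv ℝ f) :=
    (hf.fderiv_right (m := 1) (by norm_num)).differentiable (by norm_num)
  have hC0 : 0 ≤ C := le_trans (norm_nonneg (fderiv ℝ (fderiv ℝ f) a)) (hC a)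
  have hbound : ∀ y ∈ segment ℝ a b, ‖fderiv ℝ f y - fderiv ℝ f a‖ ≤ C * ‖b - a‖ := by
    intro y hy
    calc ‖fderiv ℝ f y - fderiv ℝ f a‖ ≤ C * ‖y - a‖ :=
          convex_univ.norm_image_sub_le_of_norm_fderiv_le (fun z _ => hd' z)
            (fun z _ => hC z) (Set.mem_univ a) (Set.mem_univ y)
      _ ≤ C * ‖b - a‖ := by
          gcongr
          exact norm_sub_le_of_mem_segment hy
  calc ‖f b - f a - fderiv ℝ f a (b - a)‖ ≤ C * ‖b - a‖ * ‖b - a‖ :=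
        (convex_segment a b).norm_image_sub_le_of_norm_fderiv_le' (fun z _ => hd z) hbound
          (left_mem_segment ℝ a b) (right_mem_segment ℝ a b)
    _ = C * ‖b - a‖ ^ 2 := by ring

/-- The linearization estimate: with `η = μ − x`, one has `η(0) = 0` and
`‖η̇(t) − [μ̇(t) − f(μ(t)) + df(μ(t))η(t)]‖ ≤ ‖d²f‖_∞ ‖η(t)‖²` for all `t`. -/
theorem stmt11 (n : ℕ) (hn : 1 ≤ n) (f : (Fin n → ℝ) → Fin n → ℝ) (hf : ContDiff ℝ 2 f)
    (C : ℝ) (hC : ∀ z, ‖fderiv ℝ (fderiv ℝ f) z‖ ≤ C)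
    (x₀ : Fin n → ℝ) (x : ℝ → Fin n → ℝ) (hx0 : x 0 = x₀)
    (hx : ∀ t, HasDerivAt x (f (x t)) t)
    (μ : ℝ → Fin n → ℝ) (hμ : ContDiff ℝ 1 μ) (hμ0 : μ 0 = x₀) :
    (μ 0 - x 0 = 0) ∧
    ∀ t : ℝ, ‖deriv (fun s => μ s - x s) t -
        (deriv μ t - f (μ t) + fderiv ℝ f (μ t) (μ t - x t))‖ ≤ C * ‖μ t - x t‖ ^ 2 := by
  refine ⟨by rw [hμ0, hx0, sub_self], fun t => ?_⟩
  have hμt : HasDerivAt μ (deriv μ t) t := (hμ.differentiable (by norm_num) t).hasDerivAt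
  have hη : deriv (fun s => μ s - x s) t = deriv μ t - f (x t) := (hμt.sub (hx t)).deriv
  have hremainder : deriv μ t - f (x t) -
      (deriv μ t - f (μ t) + fderiv ℝ f (μ t) (μ t - x t)) =
      -(f (x t) - f (μ t) - fderiv ℝ f (μ t) (x t - μ t)) := by
    rw [← neg_sub (x t) (μ t), map_neg]
    abel
  rw [hη, hremainder, norm_neg, norm_sub_rev (μ t)]
  exact norm_sub_sub_fderiv_le_mul_sq hf hC (μ t) (x t)

end
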